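/- Let T be an ergodic measure-preserving transformation on a probability space and X : Ω → ℝⁿ measurable. Then the σ-algebra σ({X∘T^k}_{k≥0}) generated by X and all its shifts is equivalent modulo μ-null sets to the ordinal σ-algebra σ(𝒫(X,T)). -/

import Mathlib

open MeasureTheory Set MeasurableSpace

/-- The element of the ordinal partition `𝒫_d(X,T)` corresponding to a
permutation `π = (i₀,…,i_d)` of `{0,…,d}` (ties broken by index). -/
def ordCell {Ω : Type*} (X : Ω → ℝ) (T : Ω → Ω) (d : ℕ)
    (π : Equiv.Perm (Fin (d + 1))) : Set Ω :=
  {ω | ∀ τ : Fin d,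
    X (T^[(π τ.castSucc : ℕ)] ω) > X (T^[(π τ.succ : ℕ)] ω) ∨
    (X (T^[(π τ.castSucc : ℕ)] ω) = X (T^[(π τ.succ : ℕ)] ω) ∧
      (π τ.succ : ℕ) < (π τ.castSucc : ℕ))}

/-- The ordinal σ-algebra `σ(𝒫(X,T))`, generated by the ordinal partitions
`𝒫_d(X,T) = ⋁_i 𝒫_d(X_i,T)`, `d ≥ 1`. -/
def ordAlg {Ω : Type*} {n : ℕ} (X : Ω → Fin n → ℝ) (T : Ω → Ω) : MeasurableSpace Ω :=
  MeasurableSpace.generateFrom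
    {s | ∃ d : ℕ, 1 ≤ d ∧ ∃ i : Fin n, ∃ π : Equiv.Perm (Fin (d + 1)),
      s = ordCell (fun ω => X ω i) T d π}

open Filter Topology Function

section OrderPatterns

variable {Ω : Type*}

theorem mem_ordCell_iff_strictMono (X : Ω → ℝ) (T : Ω → Ω) (d : ℕ)
    (π : Equiv.Perm (Fin (d + 1))) (ω : Ω) :
    ω ∈ ordCell X T d π ↔ StrictMono fun i : Fin (d + 1) =>
      OrderDual.toDual (toLex (X (T^[(π i : ℕ)] ω), (π i : ℕ))) := by
  rw [Fin.strictMono_iff_lt_succ]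
  refine forall_congr' fun τ => ?_
  rw [OrderDual.toDual_lt_toDual, Prod.Lex.toLex_lt_toLex]
  simp only [gt_iff_lt, eq_comm]

theorem exists_mem_ordCell (X : Ω → ℝ) (T : Ω → Ω) (d : ℕ) (ω : Ω) :
    ∃ π, ω ∈ ordCell X T d π := by
  let f : Fin (d + 1) → (ℝ ×ₗ ℕ)ᵒᵈ := fun i =>
    OrderDual.toDual (toLex (X (T^[(i : ℕ)] ω), (i : ℕ)))
  have hf : Injective f := fun i j h => by
    have h' : (X (T^[(i : ℕ)] ω), (i : ℕ)) = (X (T^[(j : ℕ)] ω), (j : ℕ)) := h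
    exact Fin.ext (congrArg Prod.snd h')
  exact ⟨Tuple.sort f, (mem_ordCell_iff_strictMono X T d _ ω).2
    ((Tuple.monotone_sort f).strictMono_of_injective (hf.comp (Tuple.sort f).injective))⟩

theorem setOf_iterate_lt_iterate_eq_iUnion_ordCell (X : Ω → ℝ) (T : Ω → Ω) {k l : ℕ}
    (hkl : k < l) :
    {ω | X (T^[l] ω) < X (T^[k] ω)} =
      ⋃ π ∈ {π : Equiv.Perm (Fin (l + 1)) |
        π.symm ⟨k, by omega⟩ < π.symm ⟨l, by omega⟩}, ordCell X T l π := by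
  ext ω
  have key : ∀ π, ω ∈ ordCell X T l π → (X (T^[l] ω) < X (T^[k] ω) ↔
      π.symm ⟨k, by omega⟩ < π.symm ⟨l, by omega⟩) := fun π hπ => by
    rw [mem_ordCell_iff_strictMono] at hπ
    rw [← hπ.lt_iff_lt, OrderDual.toDual_lt_toDual, Prod.Lex.toLex_lt_toLex]
    simp [hkl.not_gt]
  simp only [mem_ofPred_eq, mem_iUnion, exists_prop]
  constructor
  · intro h
    obtain ⟨π, hπ⟩ := exists_mem_ordCell X T l ω
    exact ⟨π, (key π hπ).1 h, hπ⟩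
  · rintro ⟨π, h, hπ⟩
    exact (key π hπ).2 h

theorem measurableSet_ordAlg_iterate_lt_iterate {n : ℕ} (X : Ω → Fin n → ℝ) (T : Ω → Ω)
    (i : Fin n) {k l : ℕ} (hkl : k < l) :
    MeasurableSet[ordAlg X T] {ω | X (T^[l] ω) i < X (T^[k] ω) i} := by
  rw [setOf_iterate_lt_iterate_eq_iUnion_ordCell (fun ω => X ω i) T hkl]
  exact MeasurableSet.biUnion (to_countable _) fun π _ =>
    measurableSet_generateFrom ⟨l, by omega, i, π, rfl⟩

theorem measurableSet_ordCell {m : MeasurableSpace Ω} {X : Ω → ℝ} {T : Ω → Ω}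
    (h : ∀ k, Measurable fun ω => X (T^[k] ω)) (d : ℕ) (π : Equiv.Perm (Fin (d + 1))) :
    MeasurableSet (ordCell X T d π) := by
  simp only [ordCell, ofPred_forall, ofPred_or, ofPred_and]
  exact MeasurableSet.iInter fun τ =>
    (measurableSet_lt (h _) (h _)).union
      ((measurableSet_eq_fun (h _) (h _)).inter (MeasurableSet.const _))

theorem ordAlg_le {m : MeasurableSpace Ω} {n : ℕ} {X : Ω → Fin n → ℝ} {T : Ω → Ω}
    (h : ∀ k, Measurable fun ω => X (T^[k] ω)) : ordAlg X T ≤ m := by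
  refine generateFrom_le ?_
  rintro _ ⟨d, -, i, π, rfl⟩
  exact measurableSet_ordCell (fun k => (measurable_pi_apply i).comp (h k)) d π

end OrderPatterns

section IndicatorAverage

variable {Ω : Type*} {T : Ω → Ω}

theorem birkhoffAverage_indicator_le {A : Set Ω} {B : ℕ → Set Ω} {N : ℕ} {ω η : Ω}
    (h : ∀ j, T^[j] η ∈ A → ω ∈ B j) :
    birkhoffAverage ℝ T (A.indicator fun _ => (1 : ℝ)) N η ≤
      (N : ℝ)⁻¹ * ∑ j ∈ Finset.range N, (B j).indicator (fun _ => (1 : ℝ)) ω := by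
  classical
  simp only [birkhoffAverage, birkhoffSum, smul_eq_mul]
  gcongr with j
  simp only [indicator_apply]
  split_ifs with h1 h2 <;> first | exact absurd (h j h1) h2 | norm_num

theorem le_birkhoffAverage_indicator {A : Set Ω} {B : ℕ → Set Ω} {N : ℕ} {ω η : Ω}
    (h : ∀ j, ω ∈ B j → T^[j] η ∈ A) :
    (N : ℝ)⁻¹ * ∑ j ∈ Finset.range N, (B j).indicator (fun _ => (1 : ℝ)) ω ≤
      birkhoffAverage ℝ T (A.indicator fun _ => (1 : ℝ)) N η := by
  classical
  simp only [birkhoffAverage, birkhoffSum, smul_eq_mul]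
  gcongr with j
  simp only [indicator_apply]
  split_ifs with h1 h2 <;> first | exact absurd (h j h1) h2 | norm_num

end IndicatorAverage

section MeanErgodic

variable {Ω : Type*} [MeasurableSpace Ω] {μ : Measure Ω} [IsProbabilityMeasure μ] {T : Ω → Ω}

/-- The frequency of visits to a measurable set along the orbits of an ergodic map converges
in measure to the measure of the set. -/
theorem Ergodic.tendstoInMeasure_birkhoffAverage_indicator (hT : Ergodic T μ) {A : Set Ω}
    (hA : MeasurableSet A) :
    TendstoInMeasure μ (birkhoffAverage ℝ T (A.indicator fun _ => (1 : ℝ))) atTop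
      fun _ => μ.real A := by
  let U : Lp ℝ 2 μ →L[ℝ] Lp ℝ 2 μ :=
    (Lp.compMeasurePreservingₗᵢ ℝ T hT.toMeasurePreserving).toContinuousLinearMap
  have hU : ∀ g : Lp ℝ 2 μ, U g =ᵐ[μ] g ∘ T := fun g =>
    Lp.coeFn_compMeasurePreserving g hT.toMeasurePreserving
  have hUn : ‖U‖ ≤ 1 := LinearIsometry.norm_toContinuousLinearMap_le _
  let x : Lp ℝ 2 μ := indicatorConstLp 2 hA (measure_ne_top μ A) (1 : ℝ)
  let e : Lp ℝ 2 μ := indicatorConstLp 2 MeasurableSet.univ (measure_ne_top μ univ) (1 : ℝ)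
  have he : e ∈ U.eqLocus (1 : Lp ℝ 2 μ →L[ℝ] Lp ℝ 2 μ) := by
    change U e = e
    refine Lp.ext ((hU e).trans ?_)
    have h1 : e =ᵐ[μ] fun _ => (1 : ℝ) := by
      refine (indicatorConstLp_coeFn (hs := MeasurableSet.univ)).trans ?_
      rw [indicator_univ]
    exact (hT.quasiMeasurePreserving.ae_eq_comp h1).trans h1.symm
  let y := (U.eqLocus (1 : Lp ℝ 2 μ →L[ℝ] Lp ℝ 2 μ)).orthogonalProjectionOnto x
  have hlim : Tendsto (birkhoffAverage ℝ U _root_.id · x) atTop (𝓝 (y : Lp ℝ 2 μ)) :=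
    U.tendsto_birkhoffAverage_orthogonalProjection hUn x
  obtain ⟨c, hc⟩ : ∃ c, (y : Lp ℝ 2 μ) =ᵐ[μ] const Ω c := by
    refine hT.ae_eq_const_of_ae_eq_comp_ae (Lp.aestronglyMeasurable _) ?_
    have h2 : U (y : Lp ℝ 2 μ) = y := y.2
    exact (hU y).symm.trans (by rw [h2])
  have hinner : ∀ g : Lp ℝ 2 μ, inner ℝ e g = ∫ ω, g ω ∂μ := fun g => by
    rw [L2.inner_indicatorConstLp_one (𝕜 := ℝ) MeasurableSet.univ (measure_ne_top μ univ) g,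
      setIntegral_univ]
  have hcA : c = μ.real A := by
    have h3 : inner ℝ e (x - (y : Lp ℝ 2 μ)) = 0 :=
      Submodule.sub_starProjection_mem_orthogonal x e he
    rw [inner_sub_right, hinner, hinner, sub_eq_zero, integral_congr_ae hc,
      integral_congr_ae (indicatorConstLp_coeFn (hs := hA)), integral_indicator hA] at h3
    simpa using h3.symm
  have hiter : ∀ j : ℕ, (U^[j] x : Lp ℝ 2 μ) =ᵐ[μ]
      fun ω => A.indicator (fun _ => (1 : ℝ)) (T^[j] ω) := fun j => by
    induction j with
    | zero => exact indicatorConstLp_coeFn (hs := hA) (hμs := measure_ne_top μ A)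
    | succ j ih =>
      rw [iterate_succ_apply']
      refine (hU _).trans ((hT.quasiMeasurePreserving.ae_eq_comp ih).trans ?_)
      exact Eventually.of_forall fun ω => by simp [iterate_succ_apply]
  have havg : ∀ N : ℕ, (birkhoffAverage ℝ U _root_.id N x : Lp ℝ 2 μ) =ᵐ[μ]
      birkhoffAverage ℝ T (A.indicator fun _ => (1 : ℝ)) N := fun N => by
    simp only [birkhoffAverage, birkhoffSum, _root_.id]
    filter_upwards [Lp.coeFn_smul (N : ℝ)⁻¹ (∑ j ∈ Finset.range N, U^[j] x),
      Lp.coeFn_finsetSum (Finset.range N) (fun j => (U^[j] x : Lp ℝ 2 μ)),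
      ae_all_iff.2 hiter] with ω h4 h5 h6
    rw [h4, Pi.smul_apply, h5]
    simp [h6, birkhoffAverage, birkhoffSum]
  exact (tendstoInMeasure_of_tendsto_Lp hlim).congr havg (by rw [← hcA]; exact hc)

end MeanErgodic

section Distribution

variable {Ω : Type*} [MeasurableSpace Ω] {μ : Measure Ω} [IsProbabilityMeasure μ]

/-- Almost surely, `Y < a` is witnessed by one of countably many levels `d` with
`μ {Y < d} < μ {Y < a}`. -/
theorem exists_countable_levels {Y : Ω → ℝ} (hY : Measurable Y) (a : ℝ) :
    ∃ D : Set ℝ, D.Countable ∧ (∀ d ∈ D, μ.real (Y ⁻¹' Iio d) < μ.real (Y ⁻¹' Iio a)) ∧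
      ∀ᵐ ω ∂μ, Y ω < a → ∃ d ∈ D, Y ω ≤ d := by
  let E : Set ℝ := {d | μ.real (Y ⁻¹' Iio d) < μ.real (Y ⁻¹' Iio a)}
  have hE : ∀ x ∈ E, ∃ d ∈ E, Iic d ∈ 𝓝[E] x := fun x hx => by
    by_cases h : ∃ d ∈ E, x < d
    · obtain ⟨d, hd, hxd⟩ := h
      exact ⟨d, hd, mem_nhdsWithin_of_mem_nhds (Iic_mem_nhds hxd)⟩
    · push Not at h
      exact ⟨x, hx, mem_of_superset self_mem_nhdsWithin h⟩
  choose! f hfE hf using hE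
  obtain ⟨t, htE, htc, hcover⟩ := TopologicalSpace.countable_cover_nhdsWithin hf
  refine ⟨f '' t, htc.image f, ?_, ?_⟩
  · rintro _ ⟨x, hx, rfl⟩
    exact hfE x (htE hx)
  let V : Set ℝ := {x | x < a ∧ x ∉ E}
  have hnull : ∀ x ∈ V, (μ.map Y) (Ico x a) = 0 := fun x hx => by
    rw [Measure.map_apply hY measurableSet_Ico]
    have h1 : Y ⁻¹' Ico x a = Y ⁻¹' Iio a \ Y ⁻¹' Iio x := by
      ext ω; simp [and_comm]
    have h2 : μ.real (Y ⁻¹' Iio a) ≤ μ.real (Y ⁻¹' Iio x) := not_lt.1 hx.2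
    have h3 : μ.real (Y ⁻¹' Iio a \ Y ⁻¹' Iio x) =
        μ.real (Y ⁻¹' Iio a) - μ.real (Y ⁻¹' Iio x) :=
      measureReal_sdiff (preimage_mono (Iio_subset_Iio hx.1.le)) (hY measurableSet_Iio)
    rw [h1, ← measureReal_eq_zero_iff]
    exact le_antisymm (by linarith) measureReal_nonneg
  have hV : (μ.map Y) V = 0 := by
    refine measure_null_of_locally_null V fun x hx => ?_
    by_cases h : ∃ d ∈ V, d < x
    · obtain ⟨d, hd, hdx⟩ := h
      refine ⟨Ico d a, ?_, hnull d hd⟩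
      filter_upwards [self_mem_nhdsWithin, mem_nhdsWithin_of_mem_nhds (Ioi_mem_nhds hdx)]
        with z hz hz'
      exact ⟨le_of_lt hz', hz.1⟩
    · push Not at h
      exact ⟨Ico x a, mem_of_superset self_mem_nhdsWithin fun z hz => ⟨h z hz, hz.1⟩, hnull x hx⟩
  filter_upwards [ae_of_ae_map hY.aemeasurable (measure_eq_zero_iff_ae_notMem.1 hV)] with ω hω hlt
  have hωE : Y ω ∈ E := by
    by_contra h
    exact hω ⟨hlt, h⟩
  obtain ⟨x, hx, hx'⟩ := mem_iUnion₂.1 (hcover hωE)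
  exact ⟨f x, mem_image_of_mem f hx, hx'⟩

end Distribution

section Separation

variable {Ω : Type*} {m : MeasurableSpace Ω} [MeasurableSpace Ω] {μ : Measure Ω}
  [IsProbabilityMeasure μ] {T : Ω → Ω}

/-- Comparing the value at time `k` with all later values separates two levels of the
distribution that carry different mass. -/
theorem exists_measurableSet_separating_levels (hT : Ergodic T μ) {Y : Ω → ℝ}
    (hY : Measurable Y) {k : ℕ}
    (hm : ∀ l, k < l → MeasurableSet[m] {ω | Y (T^[l] ω) < Y (T^[k] ω)}) {d a : ℝ}
    (hda : μ.real (Y ⁻¹' Iio d) < μ.real (Y ⁻¹' Iio a)) :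
    ∃ B, MeasurableSet[m] B ∧
      ∀ᵐ ω ∂μ, (Y (T^[k] ω) ≤ d → ω ∈ B) ∧ (ω ∈ B → Y (T^[k] ω) < a) := by
  obtain ⟨c, hdc, hca⟩ := exists_between hda
  obtain ⟨φ, hφ, hφd⟩ := (hT.tendstoInMeasure_birkhoffAverage_indicator
    (hY (measurableSet_Iio (a := d)))).exists_seq_tendsto_ae
  obtain ⟨ψ, hψ, hψa⟩ := ((hT.tendstoInMeasure_birkhoffAverage_indicator
    (hY (measurableSet_Iio (a := a)))).comp hφ.tendsto_atTop).exists_seq_tendsto_ae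
  let C : ℕ → Set Ω := fun j => {ω | Y (T^[j + (k + 1)] ω) < Y (T^[k] ω)}
  let g : ℕ → Ω → ℝ := fun N ω =>
    (N : ℝ)⁻¹ * ∑ j ∈ Finset.range N, (C j).indicator (fun _ => (1 : ℝ)) ω
  have hg : ∀ N, Measurable[m] (g N) := fun N => by
    refine Measurable.const_mul (Finset.measurable_sum _ fun j _ => ?_) _
    exact measurable_const.indicator (hm _ (by omega))
  refine ⟨{ω | ∀ᶠ j in atTop, g (φ (ψ j)) ω < c}, ?_, ?_⟩
  · simp only [eventually_atTop, ofPred_exists, ofPred_forall]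
    exact MeasurableSet.iUnion fun i => MeasurableSet.iInter fun j =>
      MeasurableSet.iInter fun _ => measurableSet_lt (hg _) measurable_const
  have hk := (hT.toMeasurePreserving.iterate (k + 1)).quasiMeasurePreserving
  filter_upwards [hk.ae hφd, hk.ae hψa] with ω h1 h2
  constructor
  · intro h
    filter_upwards [(h1.comp hψ.tendsto_atTop).eventually (gt_mem_nhds hdc)] with j hj
    refine (le_birkhoffAverage_indicator fun i hi => ?_).trans_lt hj
    have hi' : Y (T^[i + (k + 1)] ω) < Y (T^[k] ω) := hi
    rw [iterate_add_apply] at hi'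
    exact hi'.trans_le h
  · intro h
    by_contra! hle
    obtain ⟨j, hj1, hj2⟩ := (h.and (h2.eventually (lt_mem_nhds hca))).exists
    refine lt_irrefl c (hj2.trans_le (le_trans ?_ hj1.le))
    refine birkhoffAverage_indicator_le fun i hi => ?_
    change Y (T^[i + (k + 1)] ω) < Y (T^[k] ω)
    rw [iterate_add_apply]
    exact lt_of_lt_of_le hi hle

theorem eventuallyMeasurable_iterate (hT : Ergodic T μ) {Y : Ω → ℝ}
    (hY : Measurable Y) {k : ℕ}
    (hm : ∀ l, k < l → MeasurableSet[m] {ω | Y (T^[l] ω) < Y (T^[k] ω)}) :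
    EventuallyMeasurable m (ae μ) fun ω => Y (T^[k] ω) := by
  refine @measurable_of_Iio _ _ _ _ _ (eventuallyMeasurableSpace m (ae μ)) _ _ _ _ fun a => ?_
  obtain ⟨D, hDc, hD, hDa⟩ := exists_countable_levels (μ := μ) hY a
  choose! B hBm hB using fun d (hd : d ∈ D) =>
    exists_measurableSet_separating_levels hT hY hm (hD d hd)
  refine ⟨⋃ d ∈ D, B d, MeasurableSet.biUnion hDc hBm, ?_⟩
  have hk := (hT.toMeasurePreserving.iterate k).quasiMeasurePreserving
  refine Filter.eventuallyEq_set.2 ?_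
  filter_upwards [hk.ae hDa, (ae_ball_iff hDc).2 hB] with ω h1 h2
  simp only [mem_preimage, mem_Iio, mem_iUnion, exists_prop]
  constructor
  · intro h
    obtain ⟨d, hd, hle⟩ := h1 h
    exact ⟨d, hd, (h2 d hd).1 hle⟩
  · rintro ⟨d, hd, hω⟩
    exact (h2 d hd).2 hω

end Separation


/-- For an ergodic measure-preserving `T` and measurable
`X : Ω → ℝⁿ`, the σ-algebra `σ({X∘T^k}_{k≥0})` generated by `X` and all its
shifts is equivalent modulo `μ`-null sets to the ordinal σ-algebra `σ(𝒫(X,T))`. -/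
theorem stmt8 {Ω : Type*} [MeasurableSpace Ω] (μ : Measure Ω) [IsProbabilityMeasure μ]
    (T : Ω → Ω) (hT : Ergodic T μ)
    {n : ℕ} (X : Ω → Fin n → ℝ) (hX : Measurable X) :
    (∀ s : Set Ω,
      MeasurableSet[⨆ k : ℕ, MeasurableSpace.comap (fun ω => X (T^[k] ω)) (borel (Fin n → ℝ))] s →
      ∃ t : Set Ω, MeasurableSet[ordAlg X T] t ∧ μ (symmDiff s t) = 0) ∧
    (∀ s : Set Ω, MeasurableSet[ordAlg X T] s →
      ∃ t : Set Ω,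
        MeasurableSet[⨆ k : ℕ, MeasurableSpace.comap (fun ω => X (T^[k] ω)) (borel (Fin n → ℝ))] t ∧
        μ (symmDiff s t) = 0) := by
  have hk : ∀ k, Measurable[⨆ k : ℕ, MeasurableSpace.comap (fun ω => X (T^[k] ω))
      (borel (Fin n → ℝ))] fun ω => X (T^[k] ω) := fun k => by
    rw [measurable_iff_comap_le, BorelSpace.measurable_eq (α := Fin n → ℝ)]
    exact le_iSup (fun k : ℕ => MeasurableSpace.comap (fun ω => X (T^[k] ω))
      (borel (Fin n → ℝ))) k
  have hle : (⨆ k : ℕ, MeasurableSpace.comap (fun ω => X (T^[k] ω)) (borel (Fin n → ℝ))) ≤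
      eventuallyMeasurableSpace (ordAlg X T) (ae μ) := by
    refine iSup_le fun k => ?_
    rw [← BorelSpace.measurable_eq (α := Fin n → ℝ), ← measurable_iff_comap_le]
    refine @measurable_pi_lambda _ _ _ (eventuallyMeasurableSpace (ordAlg X T) (ae μ)) _ _
      fun i => ?_
    exact eventuallyMeasurable_iterate hT ((measurable_pi_apply i).comp hX) fun l hl =>
      measurableSet_ordAlg_iterate_lt_iterate X T i hl
  refine ⟨fun s hs => ?_, fun s hs => ⟨s, ordAlg_le hk s hs, by simp⟩⟩
  obtain ⟨t, ht, hst⟩ := hle s hs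
  exact ⟨t, ht, measure_symmDiff_eq_zero_iff.2 hst⟩
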